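/- arXiv:1305.1073 — 2 statements merged into one kernel-verified Lean document; each statement's English description precedes it below -/
import Mathlib

section
/- Let r ≥ 2 and let p, q be positive integers. Let C(p) be the family of all r-graphs G with χ(G) ≤ p and let C̲(q) be the family of all r-graphs G with χ̲(G) ≤ q. Then C(p) and C̲(q) are hereditary and multiplicative properties, and π(C(p)) = 1 − p^{−r+1}, while π(C̲(q)) = r!·C(q,r)·q^{−r}. -/
/-!
Common definitions: `r`-uniform hypergraphs on vertex set `Fin n`, the polyform,
the parameter `λ^(α)`, degrees, properties of `r`-graphs, blow-ups, extremal
numbers and chromatic numbers.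
-/

open Finset

/-- An `r`-uniform hypergraph on the vertex set `Fin n`. -/
structure HGraph (r n : ℕ) where
  edges : Finset (Finset (Fin n))
  uniform : ∀ e ∈ edges, e.card = r

namespace HGraph

/-- The polyform `P_G(x) = r! ∑_{e ∈ E(G)} ∏_{i ∈ e} x_i`. -/
noncomputable def polyform {r n : ℕ} (G : HGraph r n) (x : Fin n → ℝ) : ℝ :=
  (r.factorial : ℝ) * ∑ e ∈ G.edges, ∏ i ∈ e, x i

/-- `λ^(α)(G)`: the maximum of the polyform over the unit sphere of `ℓ^α`. -/
noncomputable def lam {r n : ℕ} (α : ℝ) (G : HGraph r n) : ℝ :=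
  sSup {y : ℝ | ∃ x : Fin n → ℝ, (∑ i, |x i| ^ α) = 1 ∧ y = G.polyform x}

/-- The degree of a vertex: the number of edges containing it. -/
def degree {r n : ℕ} (G : HGraph r n) (v : Fin n) : ℕ :=
  (G.edges.filter (fun e => v ∈ e)).card

/-- Maximum degree `Δ(G)`. -/
def maxDeg {r n : ℕ} (G : HGraph r n) : ℕ :=
  Finset.univ.sup G.degree

/-- Minimum degree `δ(G)`. -/
noncomputable def minDeg {r n : ℕ} (G : HGraph r n) : ℕ :=
  sInf (Set.range G.degree)

/-- `G` is regular if all vertices have equal degrees. -/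
def Regular {r n : ℕ} (G : HGraph r n) : Prop :=
  ∀ u v : Fin n, G.degree u = G.degree v

/-- The induced subgraph of `G` along the embedding `f`. -/
def induce {r n m : ℕ} (G : HGraph r n) (f : Fin m ↪ Fin n) : HGraph r m where
  edges := Finset.univ.filter (fun e : Finset (Fin m) => e.map f ∈ G.edges)
  uniform := by
    intro e he
    rw [Finset.mem_filter] at he
    have h2 := G.uniform _ he.2
    rwa [Finset.card_map] at h2

/-- A property of `r`-graphs: a family closed under isomorphism (relabeling). -/
def IsProperty {r : ℕ} (P : ∀ n, Set (HGraph r n)) : Prop :=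
  ∀ n : ℕ, ∀ σ : Equiv.Perm (Fin n), ∀ G ∈ P n, G.induce σ.toEmbedding ∈ P n

/-- A hereditary property: closed under taking induced subgraphs. -/
def Hereditary {r : ℕ} (P : ∀ n, Set (HGraph r n)) : Prop :=
  ∀ n m : ℕ, ∀ f : Fin m ↪ Fin n, ∀ G ∈ P n, G.induce f ∈ P m

/-- A monotone property: closed under taking subgraphs. -/
def MonotoneProp {r : ℕ} (P : ∀ n, Set (HGraph r n)) : Prop :=
  ∀ n m : ℕ, ∀ f : Fin m ↪ Fin n, ∀ G ∈ P n, ∀ H : HGraph r m,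
    (∀ e ∈ H.edges, e.map f ∈ G.edges) → H ∈ P m

/-- `B`, together with the projection `φ : V(B) → V(G)`, is (a copy of) the blow-up
`G(k 1, …, k n)` of `G`: the fiber over a vertex `i` of `G` has `k i` vertices, and the
edges of `B` are exactly the transversals of the classes corresponding to edges of `G`. -/
def IsBlowup {r n N : ℕ} (G : HGraph r n) (k : Fin n → ℕ)
    (B : HGraph r N) (φ : Fin N → Fin n) : Prop :=
  (∀ i : Fin n, (Finset.univ.filter (fun v => φ v = i)).card = k i) ∧
  ∀ s : Finset (Fin N), s ∈ B.edges ↔ (Set.InjOn φ ↑s ∧ s.image φ ∈ G.edges)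

/-- A multiplicative property: contains all blow-ups of all of its members. -/
def MultiplicativeProp {r : ℕ} (P : ∀ n, Set (HGraph r n)) : Prop :=
  ∀ n : ℕ, ∀ G ∈ P n, ∀ k : Fin n → ℕ, (∀ i, 0 < k i) →
    ∀ N : ℕ, ∀ B : HGraph r N, ∀ φ : Fin N → Fin n, IsBlowup G k B φ → B ∈ P N

/-- The extremal number `ex(P, n)`: the maximum number of edges of a member of `P`
of order `n`. -/
noncomputable def exP {r : ℕ} (P : ∀ n, Set (HGraph r n)) (n : ℕ) : ℕ :=
  sSup {m : ℕ | ∃ G ∈ P n, G.edges.card = m}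

/-- `λ^(α)(P, n)`: the maximum of `λ^(α)(G)` over members `G` of `P` of order `n`. -/
noncomputable def lamP {r : ℕ} (α : ℝ) (P : ∀ n, Set (HGraph r n)) (n : ℕ) : ℝ :=
  sSup {y : ℝ | ∃ G ∈ P n, y = lam α G}

/-- The chromatic number: the least `k` such that the vertices can be `k`-colored
with no monochromatic edge (i.e. partitioned into `k` edgeless sets). -/
noncomputable def chrom {r n : ℕ} (G : HGraph r n) : ℕ :=
  sInf {k : ℕ | ∃ c : Fin n → Fin k, ∀ e ∈ G.edges, ¬ ∀ u ∈ e, ∀ w ∈ e, c u = c w}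

/-- The weak chromatic number: the least `k` such that the vertices can be `k`-colored
with every edge getting `r` distinct colors (every class meets every edge in ≤ 1 vertex). -/
noncomputable def wchrom {r n : ℕ} (G : HGraph r n) : ℕ :=
  sInf {k : ℕ | ∃ c : Fin n → Fin k, ∀ e ∈ G.edges, Set.InjOn c ↑e}

/-- `Mon(H)`: the (monotone, hereditary) property of all `r`-graphs containing no
subgraph isomorphic to `H`. -/
def MonP {r h : ℕ} (H : HGraph r h) : ∀ n, Set (HGraph r n) :=
  fun n => {G | ¬ ∃ f : Fin h ↪ Fin n, ∀ e ∈ H.edges, e.map f ∈ G.edges}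

end HGraph

open HGraph

namespace HGraph

theorem chrom_le_iff {r n : ℕ} (hr : 2 ≤ r) (G : HGraph r n) (p : ℕ) :
    chrom G ≤ p ↔
      ∃ c : Fin n → Fin p, ∀ e ∈ G.edges, ¬ ∀ u ∈ e, ∀ w ∈ e, c u = c w := by
  refine ⟨fun h => ?_, fun h => Nat.sInf_le h⟩
  have hne : {k : ℕ | ∃ c : Fin n → Fin k,
      ∀ e ∈ G.edges, ¬ ∀ u ∈ e, ∀ w ∈ e, c u = c w}.Nonempty := by
    refine ⟨n, id, fun e he hc => ?_⟩
    have hcard : e.card ≤ 1 := Finset.card_le_one.2 hc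
    have := G.uniform e he
    omega
  obtain ⟨c, hc⟩ := Nat.sInf_mem hne
  refine ⟨fun v => Fin.castLE h (c v), fun e he hmono => hc e he fun u hu w hw => ?_⟩
  exact Fin.castLE_injective h (hmono u hu w hw)

theorem wchrom_le_iff {r n : ℕ} (G : HGraph r n) (q : ℕ) :
    wchrom G ≤ q ↔ ∃ c : Fin n → Fin q, ∀ e ∈ G.edges, Set.InjOn c ↑e := by
  refine ⟨fun h => ?_, fun h => Nat.sInf_le h⟩
  have hne : {k : ℕ | ∃ c : Fin n → Fin k, ∀ e ∈ G.edges, Set.InjOn c ↑e}.Nonempty :=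
    ⟨n, id, fun e _ => Set.injOn_id _⟩
  obtain ⟨c, hc⟩ := Nat.sInf_mem hne
  exact ⟨fun v => Fin.castLE h (c v), fun e he u hu w hw huw =>
    hc e he hu hw (Fin.castLE_injective h huw)⟩

theorem mem_edges_induce {r n m : ℕ} {G : HGraph r n} {f : Fin m ↪ Fin n}
    {e : Finset (Fin m)} : e ∈ (G.induce f).edges ↔ e.map f ∈ G.edges := by
  simp [induce]

theorem Hereditary.isProperty {r : ℕ} {P : ∀ n, Set (HGraph r n)} (h : Hereditary P) :
    IsProperty P :=
  fun n σ G hG => h n n σ.toEmbedding G hG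

theorem hereditary_chrom_le {r : ℕ} (hr : 2 ≤ r) (p : ℕ) :
    Hereditary (fun n => {G : HGraph r n | chrom G ≤ p}) := by
  intro n m f G hG
  obtain ⟨c, hc⟩ := (chrom_le_iff hr G p).1 hG
  refine (chrom_le_iff hr _ p).2 ⟨c ∘ f, fun e he hmono => hc _ (mem_edges_induce.1 he) ?_⟩
  simpa [Finset.mem_map] using hmono

theorem hereditary_wchrom_le {r : ℕ} (q : ℕ) :
    Hereditary (fun n => {G : HGraph r n | wchrom G ≤ q}) := by
  intro n m f G hG
  obtain ⟨c, hc⟩ := (wchrom_le_iff G q).1 hG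
  refine (wchrom_le_iff _ q).2 ⟨c ∘ f, fun e he u hu w hw huw => ?_⟩
  exact f.injective (hc _ (mem_edges_induce.1 he) (by simpa using hu) (by simpa using hw) huw)

theorem multiplicativeProp_chrom_le {r : ℕ} (hr : 2 ≤ r) (p : ℕ) :
    MultiplicativeProp (fun n => {G : HGraph r n | chrom G ≤ p}) := by
  intro n G hG k _ N B φ hB
  obtain ⟨c, hc⟩ := (chrom_le_iff hr G p).1 hG
  refine (chrom_le_iff hr _ p).2 ⟨c ∘ φ, fun e he hmono => hc _ ((hB.2 e).1 he).2 ?_⟩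
  simpa [Finset.mem_image] using hmono

theorem multiplicativeProp_wchrom_le {r : ℕ} (q : ℕ) :
    MultiplicativeProp (fun n => {G : HGraph r n | wchrom G ≤ q}) := by
  intro n G hG k _ N B φ hB
  obtain ⟨c, hc⟩ := (wchrom_le_iff G q).1 hG
  refine (wchrom_le_iff _ q).2 ⟨c ∘ φ, fun e he u hu w hw huw => ?_⟩
  obtain ⟨hinj, hmem⟩ := (hB.2 e).1 he
  exact hinj hu hw (hc _ hmem (by simpa using ⟨u, hu, rfl⟩) (by simpa using ⟨w, hw, rfl⟩) huw)

theorem bddAbove_card_edges {r : ℕ} (P : ∀ n, Set (HGraph r n)) (n : ℕ) :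
    BddAbove {m : ℕ | ∃ G ∈ P n, G.edges.card = m} := by
  refine ⟨Fintype.card (Finset (Fin n)), ?_⟩
  rintro m ⟨G, -, rfl⟩
  exact Finset.card_le_univ _

theorem card_edges_le_exP {r n : ℕ} {P : ∀ n, Set (HGraph r n)} {G : HGraph r n}
    (hG : G ∈ P n) : G.edges.card ≤ exP P n :=
  le_csSup (bddAbove_card_edges P n) ⟨G, hG, rfl⟩

theorem exists_card_edges_eq_exP {r n : ℕ} {P : ∀ n, Set (HGraph r n)} (h : (P n).Nonempty) :
    ∃ G ∈ P n, G.edges.card = exP P n := by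
  obtain ⟨G, hG⟩ := h
  have hne : {m : ℕ | ∃ G ∈ P n, G.edges.card = m}.Nonempty := ⟨_, G, hG, rfl⟩
  exact Nat.sSup_mem hne (bddAbove_card_edges P n)

end HGraph

/-- The set of vertices of color `i`. -/
abbrev colorClass {n p : ℕ} (c : Fin n → Fin p) (i : Fin p) : Finset (Fin n) :=
  univ.filter (fun v => c v = i)

theorem sum_card_colorClass {n p : ℕ} (c : Fin n → Fin p) :
    ∑ i, (colorClass c i).card = n := by
  have := Finset.card_eq_sum_card_fiberwise (f := c) (s := univ) (t := univ) (by simp)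
  simpa using this.symm

theorem card_filter_monochromatic {r n p : ℕ} (hr : r ≠ 0) (c : Fin n → Fin p) :
    ((univ.powersetCard r).filter (fun e => ∀ u ∈ e, ∀ w ∈ e, c u = c w)).card =
      ∑ i, (colorClass c i).card.choose r := by
  have : (univ.powersetCard r).filter (fun e => ∀ u ∈ e, ∀ w ∈ e, c u = c w) =
      univ.biUnion (fun i => (colorClass c i).powersetCard r) := by
    ext e
    simp only [mem_filter, mem_powersetCard, subset_univ, true_and, mem_biUnion, mem_univ]
    constructor
    · rintro ⟨hcard, h⟩
      obtain ⟨u, hu⟩ : e.Nonempty := Finset.card_pos.1 (by omega)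
      exact ⟨c u, fun w hw => by simpa using h w hw u hu, hcard⟩
    · rintro ⟨i, hsub, hcard⟩
      refine ⟨hcard, fun u hu w hw => ?_⟩
      have h1 := hsub hu
      have h2 := hsub hw
      simp only [mem_filter, mem_univ, true_and] at h1 h2
      rw [h1, h2]
  rw [this, Finset.card_biUnion]
  · simp
  · intro i _ j _ hij
    rw [Function.onFun, Finset.disjoint_left]
    intro e hi hj
    rw [mem_powersetCard] at hi hj
    obtain ⟨u, hu⟩ : e.Nonempty := Finset.card_pos.1 (by omega)
    have h1 := hi.1 hu
    have h2 := hj.1 hu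
    simp only [mem_filter, mem_univ, true_and] at h1 h2
    exact hij (h1.symm.trans h2)

open Classical in
theorem card_filter_injOn {r n q : ℕ} (c : Fin n → Fin q) :
    ((univ.powersetCard r).filter (fun e : Finset (Fin n) => Set.InjOn c (e : Set (Fin n)))).card =
      ∑ S ∈ univ.powersetCard r, ∏ i ∈ S, (colorClass c i).card := by
  rw [Finset.card_eq_sum_card_fiberwise (f := fun e : Finset (Fin n) => e.image c) (t := univ.powersetCard r)]
  · refine Finset.sum_congr rfl fun S hS => ?_
    rw [← Finset.card_pi]
    symm
    have key : ∀ g ∈ S.pi (colorClass c), ∀ i (hi : i ∈ S), c (g i hi) = i := by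
      intro g hg i hi
      simpa using Finset.mem_pi.1 hg i hi
    refine Finset.card_bij (fun g _ => S.attach.image fun i => g i.1 i.2) ?_ ?_ ?_
    · intro g hg
      have himg : (S.attach.image fun i => g i.1 i.2).image c = S := by
        ext i
        simp only [Finset.mem_image, mem_attach, true_and, Subtype.exists]
        constructor
        · rintro ⟨_, ⟨j, hj, rfl⟩, rfl⟩
          rwa [key g hg]
        · exact fun hi => ⟨_, ⟨i, hi, rfl⟩, key g hg i hi⟩
      have hinj : Set.InjOn c ↑(S.attach.image fun i => g i.1 i.2) := by
        intro u hu w hw huw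
        simp only [coe_image, Set.mem_image, mem_coe, mem_attach, true_and, Subtype.exists] at hu hw
        obtain ⟨i, hi, rfl⟩ := hu
        obtain ⟨j, hj, rfl⟩ := hw
        rw [key g hg, key g hg] at huw
        subst huw
        rfl
      simp only [mem_filter, mem_powersetCard, subset_univ, true_and]
      refine ⟨⟨?_, hinj⟩, himg⟩
      rw [← Finset.card_image_of_injOn hinj, himg]
      exact (mem_powersetCard.1 hS).2
    · intro g hg g' hg' h
      funext i hi
      have : g i hi ∈ S.attach.image fun i => g' i.1 i.2 := by
        rw [← h]
        exact Finset.mem_image.2 ⟨⟨i, hi⟩, mem_attach _ _, rfl⟩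
      obtain ⟨⟨j, hj⟩, -, hji⟩ := Finset.mem_image.1 this
      have hij : j = i := by rw [← key g' hg' j hj, hji, key g hg]
      subst hij
      exact hji.symm
    · intro e he
      simp only [mem_filter, mem_powersetCard, subset_univ, true_and] at he
      obtain ⟨⟨-, hinj⟩, rfl⟩ := he
      have hex : ∀ i (_ : i ∈ e.image c), ∃ v ∈ e, c v = i := fun i hi => Finset.mem_image.1 hi
      choose g hg hcg using hex
      refine ⟨g, ?_, ?_⟩
      · simp [Finset.mem_pi, hcg]
      · ext v
        simp only [Finset.mem_image, mem_attach, true_and, Subtype.exists]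
        constructor
        · rintro ⟨i, hi, rfl⟩
          exact hg _ _
        · exact fun hv => ⟨c v, ⟨v, hv, rfl⟩, hinj (hg _ _) hv (hcg _ _)⟩
  · intro e he
    simp only [coe_filter, Set.mem_ofPred_eq, mem_powersetCard, subset_univ, true_and] at he
    simpa [Finset.card_image_of_injOn he.2] using he.1

theorem pow_add_mul_le_pow_add {s h : ℝ} (hs : 0 ≤ s) (hsh : 0 ≤ s + h) (r : ℕ) :
    s ^ (r + 1) + (r + 1) * s ^ r * h ≤ (s + h) ^ (r + 1) := by
  induction r with
  | zero => simp
  | succ r ih =>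
    have := mul_le_mul_of_nonneg_right ih hsh
    have h2 : 0 ≤ (r + 1) * s ^ r * h ^ 2 := by positivity
    rw [pow_succ (s + h) (r + 1)]
    refine le_trans ?_ this
    push_cast
    have e : (s ^ (r + 1) + (r + 1) * s ^ r * h) * (s + h) =
      s ^ (r + 1 + 1) + ((r : ℝ) + 1 + 1) * s ^ (r + 1) * h + (r + 1) * s ^ r * h ^ 2 := by ring
    linarith

/-- Maclaurin's inequality between an elementary symmetric sum and the arithmetic mean `s`. -/
theorem sum_powersetCard_prod_le {ι : Type*} [DecidableEq ι] (A : Finset ι) (x : ι → ℝ)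
    (hx : ∀ i, 0 ≤ x i) (s : ℝ) (hs : ∑ i ∈ A, x i = A.card * s) (r : ℕ) :
    ∑ S ∈ A.powersetCard r, ∏ i ∈ S, x i ≤ (A.card.choose r : ℝ) * s ^ r := by
  induction A using Finset.induction_on generalizing s r with
  | empty =>
    cases r with
    | zero => simp
    | succ r => simp [Finset.powersetCard_eq_empty.2 (show (∅ : Finset ι).card < r + 1 by simp)]
  | insert a A ha ih =>
    cases r with
    | zero => simp
    | succ r =>
      obtain ⟨t, ht0, ht⟩ : ∃ t : ℝ, 0 ≤ t ∧ ∑ i ∈ A, x i = A.card * t := by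
        refine ⟨(∑ i ∈ A, x i) / A.card,
          div_nonneg (Finset.sum_nonneg fun i _ => hx i) (Nat.cast_nonneg _), ?_⟩
        rcases A.eq_empty_or_nonempty with rfl | hA
        · simp
        · have : (A.card : ℝ) ≠ 0 := by simpa using hA.ne_empty
          field_simp
      have h1 := ih t ht r
      have h2 := ih t ht (r + 1)
      rw [Finset.sum_insert ha, ht, Finset.card_insert_of_notMem ha] at hs
      push_cast at hs
      have hk : (0 : ℝ) < A.card + 1 := by positivity
      have hs0 : 0 ≤ s := by
        have h3 : 0 ≤ (A.card + 1 : ℝ) * s := by rw [← hs]; have := hx a; positivity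
        exact nonneg_of_mul_nonneg_right h3 hk
      have hB := pow_add_mul_le_pow_add (h := s - t) ht0 (by linarith) r
      rw [add_sub_cancel] at hB
      have hsum : ∑ S ∈ (insert a A).powersetCard (r + 1), ∏ i ∈ S, x i =
          ∑ S ∈ A.powersetCard (r + 1), ∏ i ∈ S, x i +
            x a * ∑ S ∈ A.powersetCard r, ∏ i ∈ S, x i := by
        rw [Finset.powersetCard_succ_insert ha, Finset.sum_union, Finset.sum_image,
          Finset.mul_sum]
        · congr 1
          refine Finset.sum_congr rfl fun S hS => Finset.prod_insert fun h => ha ?_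
          exact (mem_powersetCard.1 hS).1 h
        · intro S hS T hT hST
          have hS' : a ∉ S := fun h => ha ((mem_powersetCard.1 hS).1 h)
          have hT' : a ∉ T := fun h => ha ((mem_powersetCard.1 hT).1 h)
          rw [← Finset.erase_insert hS', hST, Finset.erase_insert hT']
        · rw [Finset.disjoint_left]
          intro S hS hS'
          obtain ⟨T, -, rfl⟩ := Finset.mem_image.1 hS'
          exact ha ((mem_powersetCard.1 hS).1 (Finset.mem_insert_self a T))
      rw [hsum, Finset.card_insert_of_notMem ha]
      have hc1 : ((A.card + 1).choose (r + 1) : ℝ) = A.card.choose r + A.card.choose (r + 1) := by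
        exact_mod_cast Nat.choose_succ_succ _ _
      have hc2 : ((A.card : ℝ) + 1) * A.card.choose r = (A.card + 1).choose (r + 1) * (r + 1) := by
        exact_mod_cast Nat.add_one_mul_choose_eq _ _
      have h1' := mul_le_mul_of_nonneg_left h1 (hx a)
      have hB' := mul_le_mul_of_nonneg_left hB
        (Nat.cast_nonneg (α := ℝ) ((A.card + 1).choose (r + 1)))
      refine le_trans (add_le_add h2 h1') (le_trans (le_of_eq ?_) hB')
      have e1 : ((A.card + 1).choose (r + 1) : ℝ) * (t ^ (r + 1) + (r + 1) * t ^ r * (s - t)) =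
          ((A.card + 1).choose (r + 1) : ℝ) * t ^ (r + 1) +
          ((A.card + 1).choose (r + 1) * (r + 1)) * t ^ r * (s - t) := by ring
      rw [e1, ← hc2, hc1]
      linear_combination (A.card.choose r : ℝ) * t ^ r * hs

/-- The coloring of `Fin n` by residues modulo `p`, whose classes are as equal as possible. -/
def residueColoring (n : ℕ) {p : ℕ} (hp : 0 < p) (v : Fin n) : Fin p :=
  ⟨v % p, Nat.mod_lt _ hp⟩

theorem card_colorClass_residueColoring (n : ℕ) {p : ℕ} (hp : 0 < p) (i : Fin p) :
    (colorClass (residueColoring n hp) i).card = n / p + if (i : ℕ) < n % p then 1 else 0 := by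
  have h := Nat.count_modEq_card n hp i
  rw [Nat.mod_eq_of_lt i.2] at h
  rw [← h, Nat.count_eq_card_filter_range, ← Finset.card_map Fin.valEmbedding]
  congr 1
  ext v
  simp only [mem_map, mem_filter, mem_univ, true_and, Fin.valEmbedding_apply, mem_range,
    residueColoring, Fin.ext_iff, Nat.ModEq, Nat.mod_eq_of_lt i.2]
  constructor
  · rintro ⟨a, ha, rfl⟩
    exact ⟨a.2, ha⟩
  · rintro ⟨hv, hvi⟩
    exact ⟨⟨v, hv⟩, hvi, rfl⟩

theorem card_colorClass_residueColoring_le (n : ℕ) {p : ℕ} (hp : 0 < p) (i : Fin p) :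
    ((colorClass (residueColoring n hp) i).card : ℝ) ≤ 1 + (p : ℝ)⁻¹ * n := by
  have h1 : (colorClass (residueColoring n hp) i).card ≤ 1 + n / p := by
    rw [card_colorClass_residueColoring]
    split_ifs <;> omega
  have h2 : ((n / p : ℕ) : ℝ) ≤ n / p := Nat.cast_div_le
  have h3 : ((colorClass (residueColoring n hp) i).card : ℝ) ≤ 1 + (n / p : ℕ) := by
    exact_mod_cast h1
  rw [inv_mul_eq_div]
  linarith

theorem le_card_colorClass_residueColoring (n : ℕ) {p : ℕ} (hp : 0 < p) (i : Fin p) :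
    -1 + (p : ℝ)⁻¹ * n ≤ ((colorClass (residueColoring n hp) i).card : ℝ) := by
  have h1 : n / p ≤ (colorClass (residueColoring n hp) i).card := by
    rw [card_colorClass_residueColoring]
    exact Nat.le_add_right _ _
  have h2 : (n : ℝ) / p ≤ (n / p : ℕ) + 1 := by
    rw [← Nat.floor_div_eq_div (K := ℝ)]
    exact (Nat.lt_floor_add_one _).le
  have h3 : ((n / p : ℕ) : ℝ) ≤ (colorClass (residueColoring n hp) i).card := by
    exact_mod_cast h1
  rw [inv_mul_eq_div]
  linarith

theorem factorial_mul_choose_le_pow (n r : ℕ) :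
    (r.factorial : ℝ) * n.choose r ≤ (n : ℝ) ^ r := by
  have := Nat.descFactorial_le_pow n r
  rw [Nat.descFactorial_eq_factorial_mul_choose] at this
  exact_mod_cast this

theorem pow_sub_le_factorial_mul_choose (n r : ℕ) :
    (((n + 1 - r : ℕ) : ℝ)) ^ r ≤ (r.factorial : ℝ) * n.choose r := by
  have := Nat.pow_sub_le_descFactorial n r
  rw [Nat.descFactorial_eq_factorial_mul_choose] at this
  exact_mod_cast this

theorem le_sum_choose {r n p : ℕ} (c : Fin n → Fin p)
    (hn : p * (r + 1) ≤ n) :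
    (n - p * (r + 1 : ℕ) : ℝ) ^ (r + 1) / (p : ℝ) ^ r ≤
      ((r + 1).factorial : ℝ) * ∑ i, ((colorClass c i).card.choose (r + 1) : ℝ) := by
  have h1 : (n - p * (r + 1 : ℕ) : ℝ) ≤
      ∑ i, (((colorClass c i).card + 1 - (r + 1) : ℕ) : ℝ) := by
    have h : ∑ i, (((colorClass c i).card : ℝ) - (r + 1 : ℕ)) ≤
        ∑ i, (((colorClass c i).card + 1 - (r + 1) : ℕ) : ℝ) := by
      refine Finset.sum_le_sum fun i _ => ?_
      rw [sub_le_iff_le_add]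
      exact_mod_cast (by omega : (colorClass c i).card ≤
        (colorClass c i).card + 1 - (r + 1) + (r + 1))
    rw [Finset.sum_sub_distrib] at h
    have h' : ∑ i, ((colorClass c i).card : ℝ) = n := by exact_mod_cast sum_card_colorClass c
    rw [h', Finset.sum_const, Finset.card_univ, Fintype.card_fin, nsmul_eq_mul] at h
    exact h
  have h0 : (0 : ℝ) ≤ n - p * (r + 1 : ℕ) := by
    rw [sub_nonneg]
    exact_mod_cast hn
  have h2 := pow_sum_div_card_le_sum_pow (s := (univ : Finset (Fin p)))
    (f := fun i => (((colorClass c i).card + 1 - (r + 1) : ℕ) : ℝ))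
    (fun i _ => Nat.cast_nonneg _) r
  rw [Finset.card_univ, Fintype.card_fin] at h2
  rw [Finset.mul_sum]
  calc _ ≤ _ := by gcongr
    _ ≤ _ := h2
    _ ≤ _ := Finset.sum_le_sum fun i _ => pow_sub_le_factorial_mul_choose _ _

/-- The `r`-graph of all non-monochromatic `r`-sets of a coloring. -/
def nonMonochromaticGraph (r : ℕ) {n p : ℕ} (c : Fin n → Fin p) : HGraph r n where
  edges := (univ.powersetCard r).filter (fun e => ¬ ∀ u ∈ e, ∀ w ∈ e, c u = c w)
  uniform _ he := (mem_powersetCard.1 (mem_filter.1 he).1).2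

theorem card_edges_nonMonochromaticGraph {r n p : ℕ} (hr : r ≠ 0) (c : Fin n → Fin p) :
    ∑ i, (colorClass c i).card.choose r + (nonMonochromaticGraph r c).edges.card =
      n.choose r := by
  rw [← card_filter_monochromatic hr, nonMonochromaticGraph,
    Finset.card_filter_add_card_filter_not]
  simp

open Classical in
/-- The `r`-graph of all rainbow `r`-sets of a coloring. -/
noncomputable def rainbowGraph (r : ℕ) {n q : ℕ} (c : Fin n → Fin q) : HGraph r n where
  edges := (univ.powersetCard r).filter (fun e => Set.InjOn c ↑e)
  uniform _ he := (mem_powersetCard.1 (mem_filter.1 he).1).2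

theorem card_edges_rainbowGraph {r n q : ℕ} (c : Fin n → Fin q) :
    (rainbowGraph r c).edges.card =
      ∑ S ∈ univ.powersetCard r, ∏ i ∈ S, (colorClass c i).card :=
  card_filter_injOn c

namespace HGraph

theorem chrom_nonMonochromaticGraph_le {r n p : ℕ} (hr : 2 ≤ r) (c : Fin n → Fin p) :
    chrom (nonMonochromaticGraph r c) ≤ p :=
  (chrom_le_iff hr _ p).2 ⟨c, fun _ he => (mem_filter.1 he).2⟩

open Classical in
theorem wchrom_rainbowGraph_le {r n q : ℕ} (c : Fin n → Fin q) :
    wchrom (rainbowGraph r c) ≤ q :=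
  (wchrom_le_iff _ q).2 ⟨c, fun _ he => (mem_filter.1 he).2⟩

theorem exists_exP_chrom_add_le {r : ℕ} (hr : 2 ≤ r) {p : ℕ} (hp : 0 < p) (n : ℕ) :
    ∃ c : Fin n → Fin p, ∑ i, (colorClass c i).card.choose r +
      exP (fun n => {G : HGraph r n | chrom G ≤ p}) n ≤ n.choose r := by
  obtain ⟨G, hG, hcard⟩ := exists_card_edges_eq_exP (n := n)
    (P := fun n => {G : HGraph r n | chrom G ≤ p})
    ⟨_, chrom_nonMonochromaticGraph_le hr (residueColoring n hp)⟩
  obtain ⟨c, hc⟩ := (chrom_le_iff hr G p).1 hG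
  refine ⟨c, ?_⟩
  rw [← hcard, ← card_edges_nonMonochromaticGraph (by omega) c]
  refine Nat.add_le_add_left (Finset.card_le_card fun e he => ?_) _
  exact mem_filter.2 ⟨mem_powersetCard.2 ⟨subset_univ _, G.uniform e he⟩, hc e he⟩

theorem exists_exP_wchrom_le {r : ℕ} {q : ℕ} (hq : 0 < q) (n : ℕ) :
    ∃ c : Fin n → Fin q, exP (fun n => {G : HGraph r n | wchrom G ≤ q}) n ≤
      ∑ S ∈ univ.powersetCard r, ∏ i ∈ S, (colorClass c i).card := by
  classical
  obtain ⟨G, hG, hcard⟩ := exists_card_edges_eq_exP (n := n)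
    (P := fun n => {G : HGraph r n | wchrom G ≤ q})
    ⟨_, wchrom_rainbowGraph_le (residueColoring n hq)⟩
  obtain ⟨c, hc⟩ := (wchrom_le_iff G q).1 hG
  refine ⟨c, ?_⟩
  rw [← hcard, ← card_edges_rainbowGraph c]
  refine Finset.card_le_card fun e he => ?_
  exact mem_filter.2 ⟨mem_powersetCard.2 ⟨subset_univ _, G.uniform e he⟩, hc e he⟩

theorem exP_chrom_div_choose_le {r : ℕ} (hr : 1 ≤ r) {p : ℕ} (hp : 0 < p) {n : ℕ}
    (hn : p * (r + 1) ≤ n) :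
    (exP (fun n => {G : HGraph (r + 1) n | chrom G ≤ p}) n : ℝ) / (n.choose (r + 1) : ℝ) ≤
      1 - ((-(p * (r + 1 : ℕ)) + 1 * n) / (0 + 1 * n) : ℝ) ^ (r + 1) / (p : ℝ) ^ r := by
  obtain ⟨c, hc⟩ := exists_exP_chrom_add_le (r := r + 1) (by omega) hp n
  have hrn : r + 1 ≤ n := le_trans (Nat.le_mul_of_pos_left _ hp) hn
  have hN : (0 : ℝ) < n.choose (r + 1) := by exact_mod_cast Nat.choose_pos hrn
  have hn0 : (0 : ℝ) < n := by exact_mod_cast (by omega : 0 < n)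
  have hf : (0 : ℝ) < (r + 1).factorial := by exact_mod_cast Nat.factorial_pos _
  have hp0 : (0 : ℝ) < p := by exact_mod_cast hp
  have hc' : ∑ i, ((colorClass c i).card.choose (r + 1) : ℝ) +
      exP (fun n => {G : HGraph (r + 1) n | chrom G ≤ p}) n ≤ n.choose (r + 1) := by
    exact_mod_cast hc
  have h1 := le_sum_choose c hn
  have h2 := factorial_mul_choose_le_pow n (r + 1)
  have hb : (0 : ℝ) ≤ -(p * (r + 1 : ℕ)) + 1 * n := by
    have : ((p * (r + 1) : ℕ) : ℝ) ≤ n := by exact_mod_cast hn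
    push_cast at this ⊢
    linarith
  set X : ℝ := ((-(p * (r + 1 : ℕ)) + 1 * n) / (0 + 1 * n) : ℝ) ^ (r + 1) / (p : ℝ) ^ r with hX
  have hX0 : 0 ≤ X := by positivity
  have hnX : (n : ℝ) ^ (r + 1) * X = (n - p * (r + 1 : ℕ) : ℝ) ^ (r + 1) / (p : ℝ) ^ r := by
    rw [hX, zero_add, one_mul, div_pow, neg_add_eq_sub]
    field_simp
  have h3 := mul_le_mul_of_nonneg_right h2 hX0
  rw [hnX, mul_assoc] at h3
  have h4 := le_of_mul_le_mul_left (h3.trans h1) hf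
  rw [div_le_iff₀ hN]
  linarith

theorem le_exP_chrom_div_choose {r : ℕ} (hr : 2 ≤ r) {p : ℕ} (hp : 0 < p) {n : ℕ}
    (hn : r ≤ n) :
    1 - p * ((1 + (p : ℝ)⁻¹ * n) / ((1 - r) + 1 * n) : ℝ) ^ r ≤
      (exP (fun n => {G : HGraph r n | chrom G ≤ p}) n : ℝ) / (n.choose r : ℝ) := by
  have hN : (0 : ℝ) < n.choose r := by exact_mod_cast Nat.choose_pos hn
  have hf : (0 : ℝ) < r.factorial := by exact_mod_cast Nat.factorial_pos _
  have hcard := card_edges_nonMonochromaticGraph (r := r) (by omega) (residueColoring n hp)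
  have hle := card_edges_le_exP (P := fun n => {G : HGraph r n | chrom G ≤ p})
    (chrom_nonMonochromaticGraph_le hr (residueColoring n hp))
  have hc' : (n.choose r : ℝ) ≤
      ∑ i, ((colorClass (residueColoring n hp) i).card.choose r : ℝ) +
        exP (fun n => {G : HGraph r n | chrom G ≤ p}) n := by
    exact_mod_cast hcard.symm.le.trans (Nat.add_le_add_left hle _)
  have h1 : (r.factorial : ℝ) * ∑ i, ((colorClass (residueColoring n hp) i).card.choose r : ℝ) ≤
      p * (1 + (p : ℝ)⁻¹ * n) ^ r := by
    rw [Finset.mul_sum]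
    calc _ ≤ ∑ _i : Fin p, (1 + (p : ℝ)⁻¹ * n) ^ r := by
          refine Finset.sum_le_sum fun i _ => (factorial_mul_choose_le_pow _ _).trans ?_
          exact pow_le_pow_left₀ (Nat.cast_nonneg _) (card_colorClass_residueColoring_le n hp i) r
      _ = _ := by simp
  have h2 := pow_sub_le_factorial_mul_choose n r
  rw [Nat.cast_sub (by omega)] at h2
  push_cast at h2
  have hb : (0 : ℝ) < (1 - r) + 1 * n := by
    have : (r : ℝ) ≤ n := by exact_mod_cast hn
    linarith
  set Y : ℝ := p * ((1 + (p : ℝ)⁻¹ * n) / ((1 - r) + 1 * n) : ℝ) ^ r with hY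
  have hY0 : 0 ≤ Y := by positivity
  have hnY : ((n : ℝ) + 1 - r) ^ r * Y = p * (1 + (p : ℝ)⁻¹ * n) ^ r := by
    have e : (n : ℝ) + 1 - r = (1 - r) + 1 * n := by ring
    rw [hY, e, div_pow, mul_left_comm, mul_div_cancel₀ _ (pow_pos hb r).ne']
  have h3 := mul_le_mul_of_nonneg_right h2 hY0
  rw [hnY, mul_assoc] at h3
  have h4 := le_of_mul_le_mul_left (h1.trans h3) hf
  rw [le_div_iff₀ hN]
  linarith

theorem exP_wchrom_div_choose_le {r q : ℕ} (hq : 0 < q) {n : ℕ} (hn : r ≤ n) :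
    (exP (fun n => {G : HGraph r n | wchrom G ≤ q}) n : ℝ) / (n.choose r : ℝ) ≤
      r.factorial * q.choose r * ((0 + (q : ℝ)⁻¹ * n) / ((1 - r) + 1 * n) : ℝ) ^ r := by
  have hN : (0 : ℝ) < n.choose r := by exact_mod_cast Nat.choose_pos hn
  have hq0 : (q : ℝ) ≠ 0 := by exact_mod_cast hq.ne'
  obtain ⟨c, hc⟩ := exists_exP_wchrom_le (r := r) hq n
  have hsum : ∑ i, ((colorClass c i).card : ℝ) = n := by exact_mod_cast sum_card_colorClass c
  have h1 := sum_powersetCard_prod_le univ (fun i => ((colorClass c i).card : ℝ))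
    (fun i => Nat.cast_nonneg _) (0 + (q : ℝ)⁻¹ * n) (by simp [hsum, hq0]) r
  rw [Finset.card_univ, Fintype.card_fin] at h1
  have hc' : (exP (fun n => {G : HGraph r n | wchrom G ≤ q}) n : ℝ) ≤
      ∑ S ∈ univ.powersetCard r, ∏ i ∈ S, ((colorClass c i).card : ℝ) := by
    exact_mod_cast hc
  have h2 := pow_sub_le_factorial_mul_choose n r
  rw [Nat.cast_sub (by omega)] at h2
  push_cast at h2
  have hb : (0 : ℝ) < (1 - r) + 1 * n := by
    have : (r : ℝ) ≤ n := by exact_mod_cast hn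
    linarith
  have e : (n : ℝ) + 1 - r = (1 - r) + 1 * n := by ring
  rw [e] at h2
  rw [div_le_iff₀ hN]
  refine (hc'.trans h1).trans ?_
  rw [div_pow]
  have h3 : (1 : ℝ) ≤ r.factorial * n.choose r / ((1 - r) + 1 * n : ℝ) ^ r := by
    rwa [one_le_div (by positivity)]
  calc (q.choose r : ℝ) * (0 + (q : ℝ)⁻¹ * n) ^ r
      ≤ (q.choose r : ℝ) * (0 + (q : ℝ)⁻¹ * n) ^ r *
        (r.factorial * n.choose r / ((1 - r) + 1 * n : ℝ) ^ r) :=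
        le_mul_of_one_le_right (by positivity) h3
    _ = _ := by ring

theorem le_exP_wchrom_div_choose {r q : ℕ} (hq : 0 < q) {n : ℕ} (hn : r ≤ n) (hqn : q ≤ n) :
    r.factorial * q.choose r * ((-1 + (q : ℝ)⁻¹ * n) / (0 + 1 * n) : ℝ) ^ r ≤
      (exP (fun n => {G : HGraph r n | wchrom G ≤ q}) n : ℝ) / (n.choose r : ℝ) := by
  have hN : (0 : ℝ) < n.choose r := by exact_mod_cast Nat.choose_pos hn
  have hq0 : (0 : ℝ) < q := by exact_mod_cast hq
  have hn0 : (0 : ℝ) < n := by exact_mod_cast hq.trans_le hqn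
  have hle := card_edges_le_exP (P := fun n => {G : HGraph r n | wchrom G ≤ q})
    (wchrom_rainbowGraph_le (residueColoring n hq))
  rw [card_edges_rainbowGraph] at hle
  have hc' : ∑ S ∈ univ.powersetCard r,
      ∏ i ∈ S, ((colorClass (residueColoring n hq) i).card : ℝ) ≤
      (exP (fun n => {G : HGraph r n | wchrom G ≤ q}) n : ℝ) := by
    exact_mod_cast hle
  have hb : 0 ≤ -1 + (q : ℝ)⁻¹ * n := by
    rw [inv_mul_eq_div, neg_add_eq_sub, sub_nonneg, one_le_div hq0]
    exact_mod_cast hqn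
  have h1 : (q.choose r : ℝ) * (-1 + (q : ℝ)⁻¹ * n) ^ r ≤ ∑ S ∈ univ.powersetCard r,
      ∏ i ∈ S, ((colorClass (residueColoring n hq) i).card : ℝ) := by
    calc _ = ∑ S ∈ (univ : Finset (Fin q)).powersetCard r, (-1 + (q : ℝ)⁻¹ * n) ^ r := by simp
      _ ≤ _ := by
        refine Finset.sum_le_sum fun S hS => ?_
        rw [← (mem_powersetCard.1 hS).2, ← Finset.prod_const]
        exact Finset.prod_le_prod (fun _ _ => hb)
          fun i _ => le_card_colorClass_residueColoring n hq i
  have h2 := factorial_mul_choose_le_pow n r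
  rw [le_div_iff₀ hN]
  refine le_trans ?_ (h1.trans hc')
  rw [div_pow, zero_add, one_mul]
  have h3 : r.factorial * n.choose r / (n : ℝ) ^ r ≤ 1 := by
    rwa [div_le_one (by positivity)]
  calc _ = (q.choose r : ℝ) * (-1 + (q : ℝ)⁻¹ * n) ^ r *
        (r.factorial * n.choose r / (n : ℝ) ^ r) := by ring
    _ ≤ _ := mul_le_of_le_one_right (by positivity) h3

theorem tendsto_exP_chrom_div_choose {r : ℕ} (hr : 1 ≤ r) {p : ℕ} (hp : 0 < p) :
    Filter.Tendsto
      (fun n : ℕ => (exP (fun n => {G : HGraph (r + 1) n | chrom G ≤ p}) n : ℝ) /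
        (n.choose (r + 1) : ℝ))
      Filter.atTop (nhds (1 - 1 / (p : ℝ) ^ r)) := by
  have hp0 : (p : ℝ) ≠ 0 := by exact_mod_cast hp.ne'
  have hlow := ((tendsto_add_mul_div_add_mul_atTop_nhds (1 : ℝ) (1 - (r + 1 : ℕ)) (p : ℝ)⁻¹
    one_ne_zero).pow (r + 1)).const_mul (p : ℝ) |>.const_sub 1
  have hupp := ((tendsto_add_mul_div_add_mul_atTop_nhds (-(p * (r + 1 : ℕ)) : ℝ) 0 1
    one_ne_zero).pow (r + 1)).div_const ((p : ℝ) ^ r) |>.const_sub 1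
  have e1 : (1 : ℝ) - p * ((p : ℝ)⁻¹ / 1) ^ (r + 1) = 1 - 1 / (p : ℝ) ^ r := by
    rw [div_one, inv_pow, pow_succ]
    field_simp
  have e2 : (1 : ℝ) - (1 / 1) ^ (r + 1) / (p : ℝ) ^ r = 1 - 1 / (p : ℝ) ^ r := by simp
  rw [e1] at hlow
  rw [e2] at hupp
  refine tendsto_of_tendsto_of_tendsto_of_le_of_le' hlow hupp ?_ ?_
  · filter_upwards [Filter.eventually_ge_atTop (r + 1)] with n hn
    exact le_exP_chrom_div_choose (by omega) hp hn
  · filter_upwards [Filter.eventually_ge_atTop (p * (r + 1))] with n hn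
    exact exP_chrom_div_choose_le hr hp hn

theorem tendsto_exP_wchrom_div_choose (r : ℕ) {q : ℕ} (hq : 0 < q) :
    Filter.Tendsto
      (fun n : ℕ => (exP (fun n => {G : HGraph r n | wchrom G ≤ q}) n : ℝ) / (n.choose r : ℝ))
      Filter.atTop (nhds ((r.factorial : ℝ) * (q.choose r : ℝ) / (q : ℝ) ^ r)) := by
  have hlow := ((tendsto_add_mul_div_add_mul_atTop_nhds (-1 : ℝ) 0 (q : ℝ)⁻¹
    one_ne_zero).pow r).const_mul (r.factorial * q.choose r : ℝ)
  have hupp := ((tendsto_add_mul_div_add_mul_atTop_nhds (0 : ℝ) (1 - r) (q : ℝ)⁻¹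
    one_ne_zero).pow r).const_mul (r.factorial * q.choose r : ℝ)
  rw [div_one, inv_pow, ← div_eq_mul_inv] at hlow hupp
  refine tendsto_of_tendsto_of_tendsto_of_le_of_le' hlow hupp ?_ ?_
  · filter_upwards [Filter.eventually_ge_atTop r, Filter.eventually_ge_atTop q] with n hn hqn
    exact le_exP_wchrom_div_choose hq hn hqn
  · filter_upwards [Filter.eventually_ge_atTop r] with n hn
    exact exP_wchrom_div_choose_le hq hn

end HGraph

/-- Proposition 9: the families `C(p)` of `r`-graphs with chromatic
number at most `p` and `C̲(q)` of `r`-graphs with weak chromatic number at most `q` are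
hereditary, multiplicative properties, with `π(C(p)) = 1 − p^{−r+1}` and
`π(C̲(q)) = r!·C(q,r)·q^{−r}`. -/
theorem stmt15 {r : ℕ} (hr : 2 ≤ r) (p q : ℕ) (hp : 0 < p) (hq : 0 < q) :
    (IsProperty (fun n => {G : HGraph r n | chrom G ≤ p}) ∧
     Hereditary (fun n => {G : HGraph r n | chrom G ≤ p}) ∧
     MultiplicativeProp (fun n => {G : HGraph r n | chrom G ≤ p})) ∧
    (IsProperty (fun n => {G : HGraph r n | wchrom G ≤ q}) ∧
     Hereditary (fun n => {G : HGraph r n | wchrom G ≤ q}) ∧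
     MultiplicativeProp (fun n => {G : HGraph r n | wchrom G ≤ q})) ∧
    Filter.Tendsto
      (fun n : ℕ => (exP (fun n => {G : HGraph r n | chrom G ≤ p}) n : ℝ) / (n.choose r : ℝ))
      Filter.atTop (nhds (1 - 1 / (p : ℝ) ^ (r - 1))) ∧
    Filter.Tendsto
      (fun n : ℕ => (exP (fun n => {G : HGraph r n | wchrom G ≤ q}) n : ℝ) / (n.choose r : ℝ))
      Filter.atTop (nhds ((r.factorial : ℝ) * (q.choose r : ℝ) / (q : ℝ) ^ r)) := by
  refine ⟨⟨(hereditary_chrom_le hr p).isProperty, hereditary_chrom_le hr p,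
    multiplicativeProp_chrom_le hr p⟩, ⟨(hereditary_wchrom_le q).isProperty,
    hereditary_wchrom_le q, multiplicativeProp_wchrom_le q⟩, ?_,
    tendsto_exP_wchrom_div_choose r hq⟩
  obtain ⟨s, rfl⟩ : ∃ s, r = s + 1 := ⟨r - 1, by omega⟩
  exact tendsto_exP_chrom_div_choose (by omega) hp
end

section
/- Let r ≥ 2, let α ≥ 1 be a real number, and let G be an r-graph. Then λ^(α)(G) ≤ (1 − χ(G)^{−r+1})^{1/α}·(r!·e(G))^{1−1/α}, and also λ^(α)(G) ≤ r!·C(χ̲(G), r)^{1/α}·χ̲(G)^{−r/α}·e(G)^{1−1/α}, where χ(G) and χ̲(G) are the chromatic and weak chromatic numbers of G. -/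
/-!
Common definitions: `r`-uniform hypergraphs on vertex set `Fin n`, the polyform,
the parameter `λ^(α)`, degrees, properties of `r`-graphs, blow-ups, extremal
numbers and chromatic numbers.
-/

open Finset

open HGraph

section SymmetricSums

variable {ι : Type*} [Fintype ι] [DecidableEq ι]

lemma card_filter_image_univ_eq {r : ℕ} {e : Finset ι} (he : e.card = r) :
    (univ.filter (fun f : Fin r → ι => univ.image f = e)).card = r.factorial := by
  have hcard : Fintype.card (Fin r) = Fintype.card e := by simp [he]
  have hperm : Fintype.card (Fin r ≃ e) = r.factorial := by
    rw [Fintype.card_equiv (Fintype.equivOfCardEq hcard), Fintype.card_fin]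
  rw [← hperm, ← Finset.card_univ]
  symm
  refine Finset.card_bij (fun σ _ a => ((σ a : e) : ι)) ?_ ?_ ?_
  · intro σ _
    simp only [mem_filter, mem_univ, true_and]
    ext v
    simp only [mem_image, mem_univ, true_and]
    constructor
    · rintro ⟨a, rfl⟩
      exact (σ a).2
    · intro hv
      exact ⟨σ.symm ⟨v, hv⟩, by simp⟩
  · intro σ _ τ _ h
    ext a
    exact congrFun h a
  · intro f hf
    simp only [mem_filter, mem_univ, true_and] at hf
    have hmem : ∀ a, f a ∈ e := fun a => hf ▸ mem_image_of_mem f (mem_univ a)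
    have hsurj : Function.Surjective (fun a => (⟨f a, hmem a⟩ : e)) := by
      rintro ⟨v, hv⟩
      rw [← hf] at hv
      obtain ⟨a, -, rfl⟩ := mem_image.1 hv
      exact ⟨a, rfl⟩
    exact ⟨Equiv.ofBijective _
      ((Fintype.bijective_iff_surjective_and_card _).2 ⟨hsurj, hcard⟩), mem_univ _, rfl⟩

/-- Each `r`-set contributes to a sum over `r`-tuples once for each of its `r!` orderings. -/
lemma sum_filter_image_univ_mem {r : ℕ} (A : Finset (Finset ι)) (hA : ∀ e ∈ A, e.card = r)
    (y : ι → ℝ) :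
    ∑ f : Fin r → ι with univ.image f ∈ A, ∏ a, y (f a) =
      (r.factorial : ℝ) * ∑ e ∈ A, ∏ i ∈ e, y i := by
  rw [← Finset.sum_fiberwise_of_maps_to (t := A) (g := fun f : Fin r → ι => univ.image f)
    (by simp), mul_sum]
  refine sum_congr rfl fun e he => ?_
  have hfilter : (univ.filter (fun f : Fin r → ι => univ.image f ∈ A)).filter
      (fun f => univ.image f = e) = univ.filter (fun f : Fin r → ι => univ.image f = e) := by
    ext f
    simp only [mem_filter, mem_univ, true_and, and_iff_right_iff_imp]
    rintro rfl
    exact he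
  rw [hfilter, ← card_filter_image_univ_eq (hA e he), ← nsmul_eq_mul, ← sum_const]
  refine sum_congr rfl fun f hf => ?_
  have hfe := (mem_filter.1 hf).2
  have hinj : Set.InjOn f ↑(univ : Finset (Fin r)) := by
    rw [← card_image_iff, hfe, hA e he, card_univ, Fintype.card_fin]
  rw [← hfe, prod_image hinj]

lemma sum_filter_injective (r : ℕ) (y : ι → ℝ) :
    ∑ f : Fin r → ι with Function.Injective f, ∏ a, y (f a) =
      (r.factorial : ℝ) * ∑ S ∈ powersetCard r univ, ∏ i ∈ S, y i := by
  rw [← sum_filter_image_univ_mem _ (fun e he => (mem_powersetCard.1 he).2)]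
  refine sum_congr (filter_congr fun f _ => ?_) fun _ _ => rfl
  rw [mem_powersetCard, and_iff_right (subset_univ _), ← Set.injOn_univ, ← coe_univ,
    ← card_image_iff, card_univ, Fintype.card_fin]

lemma sum_filter_notMem_powersetCard (r : ℕ) (y : ι → ℝ) :
    ∑ S ∈ powersetCard r (univ : Finset ι), ∑ i with i ∉ S, y i * ∏ j ∈ S, y j =
      ((r : ℝ) + 1) * ∑ T ∈ powersetCard (r + 1) univ, ∏ j ∈ T, y j := by
  have h : ((r : ℝ) + 1) * ∑ T ∈ powersetCard (r + 1) (univ : Finset ι), ∏ j ∈ T, y j =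
      ∑ T ∈ powersetCard (r + 1) (univ : Finset ι), ∑ _i ∈ T, ∏ j ∈ T, y j := by
    rw [mul_sum]
    refine sum_congr rfl fun T hT => ?_
    rw [sum_const, (mem_powersetCard.1 hT).2, nsmul_eq_mul, Nat.cast_succ]
  rw [h, sum_sigma', sum_sigma']
  refine sum_bij' (fun p _ => ⟨insert p.2 p.1, p.2⟩) (fun p _ => ⟨p.1.erase p.2, p.2⟩)
    ?_ ?_ ?_ ?_ ?_
  · rintro ⟨S, i⟩ hp
    simp only [mem_sigma, mem_powersetCard, subset_univ, true_and, mem_filter, mem_univ] at hp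
    simp [mem_sigma, mem_powersetCard, card_insert_of_notMem hp.2, hp.1]
  · rintro ⟨T, i⟩ hp
    simp only [mem_sigma, mem_powersetCard, subset_univ, true_and] at hp
    simp [mem_sigma, mem_powersetCard, card_erase_of_mem hp.2, hp.1]
  · rintro ⟨S, i⟩ hp
    simp only [mem_sigma, mem_filter, mem_univ, true_and] at hp
    simp [erase_insert hp.2]
  · rintro ⟨T, i⟩ hp
    simp only [mem_sigma] at hp
    simp [insert_erase hp.2]
  · rintro ⟨S, i⟩ hp
    simp only [mem_sigma, mem_filter, mem_univ, true_and] at hp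
    simp [prod_insert hp.2]

lemma monovary_sum_filter_mem_powersetCard (r : ℕ) {y : ι → ℝ} (hy : ∀ i, 0 ≤ y i) :
    Monovary y (fun i => ∑ S ∈ powersetCard r univ with i ∈ S, ∏ j ∈ S, y j) := by
  suffices key : ∀ i j, y i ≤ y j →
      ∑ S ∈ powersetCard r univ with i ∈ S, ∏ l ∈ S, y l ≤
        ∑ S ∈ powersetCard r univ with j ∈ S, ∏ l ∈ S, y l by
    intro i j hij
    by_contra! h
    exact absurd (key j i h.le) (not_le.2 hij)
  intro i j hij
  have hswap : ∑ S ∈ powersetCard r univ with j ∈ S, ∏ l ∈ S, y l =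
      ∑ S ∈ powersetCard r univ with i ∈ S, ∏ l ∈ S, y (Equiv.swap i j l) := by
    symm
    refine sum_bij' (fun S _ => S.map (Equiv.swap i j).toEmbedding)
      (fun S _ => S.map (Equiv.swap i j).toEmbedding) ?_ ?_ ?_ ?_ ?_
    · intro S hS
      simp only [mem_filter, mem_powersetCard, subset_univ, true_and] at hS ⊢
      exact ⟨by rw [card_map, hS.1], mem_map.2 ⟨i, hS.2, by simp⟩⟩
    · intro S hS
      simp only [mem_filter, mem_powersetCard, subset_univ, true_and] at hS ⊢
      exact ⟨by rw [card_map, hS.1], mem_map.2 ⟨j, hS.2, by simp⟩⟩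
    · intro S _
      ext l
      simp [mem_map_equiv]
    · intro S _
      ext l
      simp [mem_map_equiv]
    · intro S _
      simp [prod_map]
  rw [hswap]
  refine sum_le_sum fun S hS => ?_
  have hiS : i ∈ S := (mem_filter.1 hS).2
  by_cases hjS : j ∈ S
  · refine le_of_eq ?_
    have hmap : S.map (Equiv.swap i j).toEmbedding = S := by
      ext l
      rw [mem_map_equiv, Equiv.symm_swap]
      rcases eq_or_ne l i with rfl | hli
      · simp [hiS, hjS]
      rcases eq_or_ne l j with rfl | hlj
      · simp [hiS, hjS]
      rw [Equiv.swap_apply_of_ne_of_ne hli hlj]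
    conv_lhs => rw [← hmap]
    rw [prod_map]
    rfl
  · refine prod_le_prod (fun l _ => hy l) fun l hl => ?_
    rcases eq_or_ne l i with rfl | hli
    · simpa using hij
    · rw [Equiv.swap_apply_of_ne_of_ne hli (by rintro rfl; exact hjS hl)]

/-- One step of Maclaurin's inequality between consecutive elementary symmetric sums. -/
lemma card_mul_sum_powersetCard_succ_le (r : ℕ) {y : ι → ℝ} (hy : ∀ i, 0 ≤ y i) :
    (Fintype.card ι : ℝ) * (((r : ℝ) + 1) * ∑ S ∈ powersetCard (r + 1) univ, ∏ j ∈ S, y j) ≤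
      ((Fintype.card ι : ℝ) - r) *
        ((∑ i, y i) * ∑ S ∈ powersetCard r univ, ∏ j ∈ S, y j) := by
  have hcheb := (monovary_sum_filter_mem_powersetCard r hy).sum_mul_sum_le_card_mul_sum
  have hdeg : ∑ i, ∑ S ∈ powersetCard r univ with i ∈ S, ∏ j ∈ S, y j =
      (r : ℝ) * ∑ S ∈ powersetCard r univ, ∏ j ∈ S, y j := by
    simp_rw [sum_filter]
    rw [sum_comm, mul_sum]
    refine sum_congr rfl fun S hS => ?_
    rw [← sum_filter, filter_univ_mem, sum_const, (mem_powersetCard.1 hS).2, nsmul_eq_mul]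
  have hsplit : (∑ i, y i) * ∑ S ∈ powersetCard r univ, ∏ j ∈ S, y j =
      (∑ i, y i * ∑ S ∈ powersetCard r univ with i ∈ S, ∏ j ∈ S, y j) +
        ((r : ℝ) + 1) * ∑ S ∈ powersetCard (r + 1) univ, ∏ j ∈ S, y j := by
    rw [← sum_filter_notMem_powersetCard]
    simp_rw [sum_filter, mul_sum]
    rw [sum_comm, ← sum_add_distrib]
    refine sum_congr rfl fun S _ => ?_
    rw [sum_mul, ← sum_add_distrib]
    refine sum_congr rfl fun i _ => ?_
    by_cases h : i ∈ S <;> simp [h]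
  rw [hdeg] at hcheb
  nlinarith

/-- Maclaurin's inequality for nonnegative weights of total mass one. -/
lemma sum_powersetCard_mul_card_pow_le (r : ℕ) {y : ι → ℝ} (hy : ∀ i, 0 ≤ y i)
    (hsum : ∑ i, y i = 1) :
    (∑ S ∈ powersetCard r univ, ∏ j ∈ S, y j) * (Fintype.card ι : ℝ) ^ r ≤
      ((Fintype.card ι).choose r : ℝ) := by
  induction r with
  | zero => simp
  | succ r ih =>
    rcases le_or_gt r (Fintype.card ι) with hr | hr
    · have hstep := card_mul_sum_powersetCard_succ_le r hy
      rw [hsum, one_mul] at hstep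
      have hchoose : ((Fintype.card ι).choose (r + 1) : ℝ) * ((r : ℝ) + 1) =
          ((Fintype.card ι).choose r : ℝ) * ((Fintype.card ι : ℝ) - r) := by
        have h := Nat.choose_succ_right_eq (Fintype.card ι) r
        have h' := congrArg (Nat.cast : ℕ → ℝ) h
        push_cast [Nat.cast_sub hr] at h'
        exact h'
      have hk : (0 : ℝ) ≤ (Fintype.card ι : ℝ) - r := sub_nonneg.2 (by exact_mod_cast hr)
      have hpow : (0 : ℝ) ≤ (Fintype.card ι : ℝ) ^ r := by positivity
      refine le_of_mul_le_mul_right ?_ (by positivity : (0 : ℝ) < (r : ℝ) + 1)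
      calc _ = ((Fintype.card ι : ℝ) *
            (((r : ℝ) + 1) * ∑ S ∈ powersetCard (r + 1) univ, ∏ j ∈ S, y j)) *
              (Fintype.card ι : ℝ) ^ r := by ring
        _ ≤ (((Fintype.card ι : ℝ) - r) * ∑ S ∈ powersetCard r univ, ∏ j ∈ S, y j) *
              (Fintype.card ι : ℝ) ^ r := mul_le_mul_of_nonneg_right hstep hpow
        _ = ((Fintype.card ι : ℝ) - r) * ((∑ S ∈ powersetCard r univ, ∏ j ∈ S, y j) *
              (Fintype.card ι : ℝ) ^ r) := by ring
        _ ≤ ((Fintype.card ι : ℝ) - r) * ((Fintype.card ι).choose r : ℝ) :=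
              mul_le_mul_of_nonneg_left ih hk
        _ = _ := by rw [hchoose, mul_comm]
    · rw [powersetCard_eq_empty.2 (by rw [card_univ]; omega)]
      simp

end SymmetricSums

/-- Summing over all tuples with a prescribed colour pattern. -/
lemma sum_filter_comp_eq {ι κ : Type*} [Fintype ι] [DecidableEq κ] {r : ℕ}
    (c : ι → κ) (y : ι → ℝ) (g : Fin r → κ) :
    ∑ f : Fin r → ι with c ∘ f = g, ∏ a, y (f a) = ∏ a, ∑ i with c i = g a, y i := by
  rw [prod_univ_sum]
  refine sum_congr ?_ fun _ _ => rfl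
  ext f
  simp [Fintype.mem_piFinset, funext_iff]

namespace HGraph

variable {r n : ℕ}

lemma factorial_mul_sum_prod_le_of_coloring (hr : 2 ≤ r) (G : HGraph r n) {k : ℕ}
    (c : Fin n → Fin k) (hc : ∀ e ∈ G.edges, ¬ ∀ u ∈ e, ∀ w ∈ e, c u = c w)
    {y : Fin n → ℝ} (hy : ∀ i, 0 ≤ y i) (hsum : ∑ i, y i = 1) :
    (r.factorial : ℝ) * ∑ e ∈ G.edges, ∏ i ∈ e, y i ≤
      1 - (k : ℝ) ^ (-(r : ℝ) + 1) := by
  have : Nonempty (Fin r) := ⟨⟨0, by omega⟩⟩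
  have hclasses : ∑ j, ∑ i with c i = j, y i = 1 := by rw [sum_fiberwise, hsum]
  have hpower : (k : ℝ) ^ (-(r : ℝ) + 1) ≤ ∑ j, (∑ i with c i = j, y i) ^ r := by
    have h := pow_sum_div_card_le_sum_pow (s := univ) (f := fun j => ∑ i with c i = j, y i)
      (fun j _ => sum_nonneg fun i _ => hy i) (r - 1)
    rw [hclasses, Nat.sub_add_cancel (by omega), one_pow, card_univ, Fintype.card_fin] at h
    refine le_trans (le_of_eq ?_) h
    rw [one_div, ← Real.rpow_natCast, ← Real.rpow_neg (by positivity), Nat.cast_sub (by omega)]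
    congr 1
    push_cast
    ring
  have hmono : ∑ f : Fin r → Fin n with c ∘ f ∈ univ.image (Function.const (Fin r)),
      ∏ a, y (f a) = ∑ j, (∑ i with c i = j, y i) ^ r := by
    rw [← sum_fiberwise_of_maps_to (t := univ.image (Function.const (Fin r)))
      (g := fun f : Fin r → Fin n => c ∘ f) (by simp), sum_image
      (fun _ _ _ _ h => Function.const_injective h)]
    refine sum_congr rfl fun j _ => ?_
    have hpat : ∑ f : Fin r → Fin n with c ∘ f = Function.const (Fin r) j, ∏ a, y (f a) =
        ∏ _a : Fin r, ∑ i with c i = j, y i :=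
      sum_filter_comp_eq c y (Function.const (Fin r) j)
    rw [prod_const, card_univ, Fintype.card_fin] at hpat
    rw [← hpat, filter_filter]
    refine sum_congr (filter_congr fun f _ => and_iff_right_of_imp ?_) fun _ _ => rfl
    intro h
    rw [h]
    exact mem_image_of_mem _ (mem_univ j)
  have htotal : ∑ f : Fin r → Fin n, ∏ a, y (f a) = 1 := by
    have h := prod_univ_sum (fun _ : Fin r => (univ : Finset (Fin n))) (fun _ i => y i)
    rw [Fintype.piFinset_univ] at h
    rw [← h]
    simp [hsum]
  have hdisj : Disjoint (univ.filter fun f : Fin r → Fin n => univ.image f ∈ G.edges)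
      (univ.filter fun f : Fin r → Fin n => c ∘ f ∈ univ.image (Function.const (Fin r))) := by
    rw [disjoint_filter]
    intro f _ hf hconst
    obtain ⟨j, -, hj⟩ := mem_image.1 hconst
    have hcol : ∀ a, c (f a) = j := fun a => (congrFun hj a).symm
    refine hc _ hf ?_
    simp [hcol]
  have hle := sum_le_sum_of_subset_of_nonneg (subset_univ
    ((univ.filter fun f : Fin r → Fin n => univ.image f ∈ G.edges) ∪
      (univ.filter fun f : Fin r → Fin n => c ∘ f ∈ univ.image (Function.const (Fin r)))))
    (f := fun f => ∏ a, y (f a)) (fun f _ _ => prod_nonneg fun a _ => hy (f a))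
  rw [sum_union hdisj, sum_filter_image_univ_mem _ G.uniform, hmono, htotal] at hle
  linarith

lemma sum_prod_le_of_weak_coloring (G : HGraph r n) {k : ℕ} (hk : 0 < k)
    (c : Fin n → Fin k) (hc : ∀ e ∈ G.edges, Set.InjOn c ↑e)
    {y : Fin n → ℝ} (hy : ∀ i, 0 ≤ y i) (hsum : ∑ i, y i = 1) :
    ∑ e ∈ G.edges, ∏ i ∈ e, y i ≤ (k.choose r : ℝ) * (k : ℝ) ^ (-(r : ℝ)) := by
  have hclasses : ∑ j, ∑ i with c i = j, y i = 1 := by rw [sum_fiberwise, hsum]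
  have hmac := sum_powersetCard_mul_card_pow_le r
    (y := fun j => ∑ i with c i = j, y i) (fun j => sum_nonneg fun i _ => hy i) hclasses
  rw [Fintype.card_fin] at hmac
  have hkr : (0 : ℝ) < (k : ℝ) ^ r := by positivity
  rw [Real.rpow_neg (by positivity), Real.rpow_natCast, ← div_eq_mul_inv]
  refine le_trans ?_ ((le_div_iff₀ hkr).2 hmac)
  refine le_of_mul_le_mul_left ?_ (by positivity : (0 : ℝ) < r.factorial)
  rw [← sum_filter_injective, ← sum_filter_image_univ_mem _ G.uniform]
  have hinj : ∑ f : Fin r → Fin n with Function.Injective (c ∘ f), ∏ a, y (f a) =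
      ∑ g : Fin r → Fin k with Function.Injective g, ∏ a, ∑ i with c i = g a, y i := by
    rw [← sum_fiberwise_of_maps_to (t := univ.filter fun g : Fin r → Fin k =>
      Function.Injective g) (g := fun f : Fin r → Fin n => c ∘ f) (by simp)]
    refine sum_congr rfl fun g hg => ?_
    rw [← sum_filter_comp_eq, filter_filter]
    refine sum_congr (filter_congr fun f _ => and_iff_right_of_imp ?_) fun _ _ => rfl
    intro h
    rw [h]
    exact (mem_filter.1 hg).2
  rw [← hinj]
  refine sum_le_sum_of_subset_of_nonneg ?_ fun f _ _ => prod_nonneg fun a _ => hy (f a)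
  intro f hf
  simp only [mem_filter, mem_univ, true_and] at hf ⊢
  have hf_inj : Set.InjOn f ↑(univ : Finset (Fin r)) := by
    rw [← card_image_iff, G.uniform _ hf, card_univ, Fintype.card_fin]
  intro a b hab
  exact hf_inj (by simp) (by simp)
    (hc _ hf (by simp) (by simp) hab)

/-- The power mean inequality over the edges bounds the polyform by the edge sum of the
`α`-th powers of the coordinates. -/
lemma polyform_le {α : ℝ} (hα : 1 ≤ α) (G : HGraph r n) (x : Fin n → ℝ) :
    G.polyform x ≤ (r.factorial : ℝ) * ((G.edges.card : ℝ) ^ (1 - 1 / α) *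
      (∑ e ∈ G.edges, ∏ i ∈ e, |x i| ^ α) ^ (1 / α)) := by
  have hα0 : 0 < α := by linarith
  refine mul_le_mul_of_nonneg_left ?_ (by positivity)
  have hpow := Real.rpow_sum_le_const_mul_sum_rpow G.edges (fun e => ∏ i ∈ e, x i) hα
  have hprod : ∀ e : Finset (Fin n), |∏ i ∈ e, x i| ^ α = ∏ i ∈ e, |x i| ^ α := fun e => by
    rw [abs_prod, Real.finsetProd_rpow _ _ fun i _ => abs_nonneg _]
  simp_rw [hprod] at hpow
  have habs : (0 : ℝ) ≤ ∑ e ∈ G.edges, |∏ i ∈ e, x i| := sum_nonneg fun e _ => abs_nonneg _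
  have hedges : (0 : ℝ) ≤ ∑ e ∈ G.edges, ∏ i ∈ e, |x i| ^ α :=
    sum_nonneg fun e _ => prod_nonneg fun i _ => by positivity
  calc ∑ e ∈ G.edges, ∏ i ∈ e, x i ≤ ∑ e ∈ G.edges, |∏ i ∈ e, x i| :=
        sum_le_sum fun e _ => le_abs_self _
    _ = ((∑ e ∈ G.edges, |∏ i ∈ e, x i|) ^ α) ^ (1 / α) := by
        rw [one_div, Real.rpow_rpow_inv habs hα0.ne']
    _ ≤ ((G.edges.card : ℝ) ^ (α - 1) * ∑ e ∈ G.edges, ∏ i ∈ e, |x i| ^ α) ^ (1 / α) :=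
        Real.rpow_le_rpow (by positivity) hpow (by positivity)
    _ = _ := by
        rw [Real.mul_rpow (by positivity) hedges, ← Real.rpow_mul (by positivity)]
        congr 2
        field_simp

lemma exists_chrom_coloring (hr : 2 ≤ r) (G : HGraph r n) :
    ∃ c : Fin n → Fin (chrom G), ∀ e ∈ G.edges, ¬ ∀ u ∈ e, ∀ w ∈ e, c u = c w := by
  refine Nat.sInf_mem (s := {k : ℕ | ∃ c : Fin n → Fin k,
    ∀ e ∈ G.edges, ¬ ∀ u ∈ e, ∀ w ∈ e, c u = c w}) ⟨n, id, fun e he h => ?_⟩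
  have hcard := G.uniform e he
  have := card_le_one.2 h
  omega

lemma exists_wchrom_coloring (G : HGraph r n) :
    ∃ c : Fin n → Fin (wchrom G), ∀ e ∈ G.edges, Set.InjOn c ↑e :=
  Nat.sInf_mem (s := {k : ℕ | ∃ c : Fin n → Fin k, ∀ e ∈ G.edges, Set.InjOn c ↑e})
    ⟨n, id, fun _ _ => Function.injective_id.injOn⟩

end HGraph

/-- Theorem 8: for `α ≥ 1` and any `r`-graph `G`,
`λ^(α)(G) ≤ (1 − χ(G)^{−r+1})^{1/α}·(r!·e(G))^{1−1/α}` and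
`λ^(α)(G) ≤ r!·C(χ̲(G), r)^{1/α}·χ̲(G)^{−r/α}·e(G)^{1−1/α}`. -/
theorem stmt19 {r n : ℕ} (hr : 2 ≤ r) (α : ℝ) (hα : 1 ≤ α) (G : HGraph r n) :
    lam α G ≤ (1 - (chrom G : ℝ) ^ (-(r : ℝ) + 1)) ^ (1 / α) *
        ((r.factorial : ℝ) * G.edges.card) ^ (1 - 1 / α) ∧
    lam α G ≤ (r.factorial : ℝ) * ((wchrom G).choose r : ℝ) ^ (1 / α) *
        (wchrom G : ℝ) ^ (-(r : ℝ) / α) * (G.edges.card : ℝ) ^ (1 - 1 / α) := by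
  have hα0 : 0 < α := by linarith
  have hα1 : 0 ≤ 1 / α := by positivity
  have hnonneg : ∀ x : Fin n → ℝ, ∀ i, 0 ≤ |x i| ^ α := fun x i => by positivity
  have hedges : ∀ x : Fin n → ℝ, 0 ≤ ∑ e ∈ G.edges, ∏ i ∈ e, |x i| ^ α := fun x =>
    sum_nonneg fun e _ => prod_nonneg fun i _ => hnonneg x i
  constructor
  · obtain ⟨c, hc⟩ := exists_chrom_coloring hr G
    refine Real.sSup_le ?_ ?_
    · rintro _ ⟨x, hx, rfl⟩
      refine (polyform_le hα G x).trans ?_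
      have hbound := factorial_mul_sum_prod_le_of_coloring hr G c hc (hnonneg x) hx
      calc _ = ((r.factorial : ℝ) * ∑ e ∈ G.edges, ∏ i ∈ e, |x i| ^ α) ^ (1 / α) *
            ((r.factorial : ℝ) * G.edges.card) ^ (1 - 1 / α) := by
            rw [Real.mul_rpow (by positivity) (hedges x),
              Real.mul_rpow (by positivity) (by positivity)]
            have hfac : (r.factorial : ℝ) =
                (r.factorial : ℝ) ^ (1 - 1 / α) * (r.factorial : ℝ) ^ (1 / α) := by
              rw [← Real.rpow_add (by positivity), sub_add_cancel, Real.rpow_one]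
            nth_rewrite 1 [hfac]
            ring
        _ ≤ _ := mul_le_mul_of_nonneg_right
            (Real.rpow_le_rpow (mul_nonneg (by positivity) (hedges x)) hbound hα1)
            (by positivity)
    · refine mul_nonneg (Real.rpow_nonneg (sub_nonneg.2 ?_) _) (by positivity)
      have hneg : -(r : ℝ) + 1 < 0 := by
        have : (2 : ℝ) ≤ r := by exact_mod_cast hr
        linarith
      rcases Nat.eq_zero_or_pos (chrom G) with h0 | h0
      · rw [h0, Nat.cast_zero, Real.zero_rpow hneg.ne]
        exact zero_le_one
      · exact Real.rpow_le_one_of_one_le_of_nonpos (by exact_mod_cast h0) hneg.le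
  · obtain ⟨c, hc⟩ := exists_wchrom_coloring G
    refine Real.sSup_le ?_ (by positivity)
    rintro _ ⟨x, hx, rfl⟩
    refine (polyform_le hα G x).trans ?_
    have hpos : 0 < wchrom G := by
      rcases isEmpty_or_nonempty (Fin n) with hn | ⟨⟨i⟩⟩
      · simp at hx
      · exact (c i).pos
    have hbound := sum_prod_le_of_weak_coloring G hpos c hc (hnonneg x) hx
    calc _ ≤ (r.factorial : ℝ) * ((G.edges.card : ℝ) ^ (1 - 1 / α) *
          (((wchrom G).choose r : ℝ) * (wchrom G : ℝ) ^ (-(r : ℝ))) ^ (1 / α)) := by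
          gcongr
      _ = _ := by
          rw [Real.mul_rpow (by positivity) (by positivity), ← Real.rpow_mul (by positivity),
            mul_one_div]
          ring
end
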